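/- Let M be a Lasserre₂-feasible matrix on n qubits and let i,j,k be three distinct qubits. Then 1 + v_ij + v_ik + v_jk ≥ 0 and 1 + v_ij − v_ik − v_jk ≥ 0. -/

import Mathlib

open Matrix

/-- The 2×2 Pauli matrices `I, X, Y, Z`, indexed by `Fin 4` (with `0 ↦ I`). -/
noncomputable def pauli : Fin 4 → Matrix (Fin 2) (Fin 2) ℂ
  | 0 => 1
  | 1 => !![0, 1; 1, 0]
  | 2 => !![0, -Complex.I; Complex.I, 0]
  | 3 => !![1, 0; 0, -1]

/-- A Pauli word on `n` qubits: a choice of `I, X, Y` or `Z` for each qubit. -/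
abbrev PauliWord (n : ℕ) := Fin n → Fin 4

/-- The matrix of a Pauli word: the `n`-fold Kronecker product of its letters, realized
on `ℂ^{2^n}` identified with functions `Fin n → Fin 2`, so the entries are products of
entries of the 2×2 factors. -/
noncomputable def wordMat {n : ℕ} (w : PauliWord n) :
    Matrix (Fin n → Fin 2) (Fin n → Fin 2) ℂ :=
  Matrix.of fun f g => ∏ k, pauli (w k) (f k) (g k)

/-- The weight of a Pauli word: the number of non-identity letters. -/
def wordWeight {n : ℕ} (w : PauliWord n) : ℕ :=
  (Finset.univ.filter fun k => w k ≠ 0).card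

/-- `P_n(2)`: Pauli words on `n` qubits with at most 2 non-identity factors. -/
abbrev PauliWord2 (n : ℕ) := {w : PauliWord n // wordWeight w ≤ 2}

/-- The all-identity Pauli word, as an element of `P_n(2)`. -/
def idWord (n : ℕ) : PauliWord2 n := ⟨fun _ => 0, by simp [wordWeight]⟩

/-- The Pauli word `σ_i σ_j` with letter `σ` at positions `i` and `j` and identity
elsewhere, as an element of `P_n(2)`. -/
def pairWord {n : ℕ} (σ : Fin 4) (i j : Fin n) : PauliWord2 n :=
  ⟨fun k => if k = i ∨ k = j then σ else 0, by
    classical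
    unfold wordWeight
    have hsub : (Finset.univ.filter fun k =>
        (if k = i ∨ k = j then σ else (0 : Fin 4)) ≠ 0) ⊆ ({i, j} : Finset (Fin n)) := by
      intro k hk
      simp only [Finset.mem_filter, Finset.mem_univ, true_and] at hk
      simp only [Finset.mem_insert, Finset.mem_singleton]
      by_contra h
      push_neg at h
      exact hk (if_neg (by tauto))
    exact le_trans (Finset.card_le_card hsub)
      (by simpa using Finset.card_insert_le i ({j} : Finset (Fin n)))⟩

/-- A real symmetric matrix `M` with rows and columns indexed by `P_n(2)` is
Lasserre₂-feasible if it is positive semidefinite, has unit diagonal, vanishes at pairs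
whose Pauli product is not Hermitian, and respects equality (resp. negation) of Pauli
products. -/
def Lasserre2Feasible {n : ℕ} (M : Matrix (PauliWord2 n) (PauliWord2 n) ℝ) : Prop :=
  M.IsSymm ∧ M.PosSemidef ∧
  (∀ Γ, M Γ Γ = 1) ∧
  (∀ Γ Φ : PauliWord2 n, ¬(wordMat Γ.1 * wordMat Φ.1).IsHermitian → M Γ Φ = 0) ∧
  (∀ Γ Φ Γ' Φ' : PauliWord2 n,
    wordMat Γ.1 * wordMat Φ.1 = wordMat Γ'.1 * wordMat Φ'.1 → M Γ Φ = M Γ' Φ') ∧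
  (∀ Γ Φ Γ' Φ' : PauliWord2 n,
    wordMat Γ.1 * wordMat Φ.1 = -(wordMat Γ'.1 * wordMat Φ'.1) → M Γ Φ = -M Γ' Φ')

/-- The edge value `v_ij` from a Lasserre₂ moment matrix. -/
noncomputable def edgeVal {n : ℕ} (M : Matrix (PauliWord2 n) (PauliWord2 n) ℝ)
    (i j : Fin n) : ℝ :=
  (M (pairWord 1 i j) (idWord n) + M (pairWord 2 i j) (idWord n)
    + M (pairWord 3 i j) (idWord n)) / 3

theorem pauli_mul_self (σ : Fin 4) : pauli σ * pauli σ = 1 := by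
  fin_cases σ <;> ext a b <;> fin_cases a <;> fin_cases b <;>
    simp [pauli, Matrix.mul_apply]

/-- The product of two Pauli words is computed letter by letter. -/
theorem wordMat_mul_apply {n : ℕ} (w w' : PauliWord n) (f h : Fin n → Fin 2) :
    (wordMat w * wordMat w') f h = ∏ k, (pauli (w k) * pauli (w' k)) (f k) (h k) := by
  simp only [Matrix.mul_apply, wordMat, Matrix.of_apply, ← Finset.prod_mul_distrib]
  rw [Finset.prod_univ_sum, Fintype.piFinset_univ]

theorem wordMat_mul_congr {n : ℕ} {w w' u u' : PauliWord n}
    (h : ∀ k, pauli (w k) * pauli (w' k) = pauli (u k) * pauli (u' k)) :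
    wordMat w * wordMat w' = wordMat u * wordMat u' := by
  ext f g
  simp only [wordMat_mul_apply, h]

theorem pairWord_comm {n : ℕ} (σ : Fin 4) (i j : Fin n) : pairWord σ i j = pairWord σ j i := by
  simp only [pairWord, or_comm]

theorem wordMat_pairWord_mul_pairWord {n : ℕ} (σ : Fin 4) {i j k : Fin n}
    (hij : i ≠ j) (hik : i ≠ k) (hjk : j ≠ k) :
    wordMat (pairWord σ i j).1 * wordMat (pairWord σ i k).1 =
      wordMat (pairWord σ j k).1 * wordMat (idWord n).1 := by
  refine wordMat_mul_congr fun l => ?_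
  have h0 : pauli 0 = 1 := rfl
  by_cases hi : l = i
  · subst hi
    simp [pairWord, idWord, hij, hik, h0, pauli_mul_self]
  · by_cases hj : l = j
    · subst hj
      simp [pairWord, idWord, hi, hjk, h0]
    · simp [pairWord, idWord, hi, hj, h0]

theorem Lasserre2Feasible.pairWord_apply_pairWord {n : ℕ}
    {M : Matrix (PauliWord2 n) (PauliWord2 n) ℝ} (hM : Lasserre2Feasible M) (σ : Fin 4)
    {i j k : Fin n} (hij : i ≠ j) (hik : i ≠ k) (hjk : j ≠ k) :
    M (pairWord σ i j) (pairWord σ i k) = M (pairWord σ j k) (idWord n) :=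
  hM.2.2.2.2.1 _ _ _ _ (wordMat_pairWord_mul_pairWord σ hij hik hjk)

/-- The triangle inequalities hold for each Pauli letter separately. -/
theorem Lasserre2Feasible.letter_triangle {n : ℕ}
    {M : Matrix (PauliWord2 n) (PauliWord2 n) ℝ} (hM : Lasserre2Feasible M) (σ : Fin 4)
    {i j k : Fin n} (hij : i ≠ j) (hik : i ≠ k) (hjk : j ≠ k) :
    0 ≤ 1 + M (pairWord σ i j) (idWord n) + M (pairWord σ i k) (idWord n)
        + M (pairWord σ j k) (idWord n) ∧
      0 ≤ 1 + M (pairWord σ i j) (idWord n) - M (pairWord σ i k) (idWord n)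
        - M (pairWord σ j k) (idWord n) := by
  have hsymm : ∀ Γ Φ, M Γ Φ = M Φ Γ := fun Γ Φ => hM.1.apply Φ Γ
  have hdiag : ∀ Γ, M Γ Γ = 1 := hM.2.2.1
  have h₁ := hM.pairWord_apply_pairWord σ hij hik hjk
  have h₂ := hM.pairWord_apply_pairWord σ hij.symm hjk hik
  have h₃ := hM.pairWord_apply_pairWord σ hik.symm hjk.symm hij
  rw [pairWord_comm σ j i] at h₂
  rw [pairWord_comm σ k i, pairWord_comm σ k j] at h₃
  have hpsd := hM.2.1.submatrix
    ![idWord n, pairWord σ i j, pairWord σ i k, pairWord σ j k]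
  have hadd := hpsd.dotProduct_mulVec_nonneg ![1, 1, 1, 1]
  have hsub := hpsd.dotProduct_mulVec_nonneg ![1, 1, -1, -1]
  simp [Matrix.mulVec, dotProduct, Fin.sum_univ_four, hdiag, h₁, h₂, h₃,
    hsymm (idWord n), hsymm (pairWord σ i k) (pairWord σ i j),
    hsymm (pairWord σ j k) (pairWord σ i j),
    hsymm (pairWord σ j k) (pairWord σ i k)] at hadd hsub
  constructor <;> linarith

/-- Triangle inequalities for Lasserre₂ edge values: for a Lasserre₂-feasible matrix `M`
on `n` qubits and three distinct qubits `i, j, k`, one has `1 + v_ij + v_ik + v_jk ≥ 0`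
and `1 + v_ij − v_ik − v_jk ≥ 0`. -/
theorem lasserre2_triangle {n : ℕ} (M : Matrix (PauliWord2 n) (PauliWord2 n) ℝ)
    (hM : Lasserre2Feasible M) (i j k : Fin n)
    (hij : i ≠ j) (hik : i ≠ k) (hjk : j ≠ k) :
    1 + edgeVal M i j + edgeVal M i k + edgeVal M j k ≥ 0 ∧
      1 + edgeVal M i j - edgeVal M i k - edgeVal M j k ≥ 0 := by
  obtain ⟨hX, hX'⟩ := hM.letter_triangle 1 hij hik hjk
  obtain ⟨hY, hY'⟩ := hM.letter_triangle 2 hij hik hjk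
  obtain ⟨hZ, hZ'⟩ := hM.letter_triangle 3 hij hik hjk
  unfold edgeVal
  constructor <;> linarith
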